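/- arXiv:1910.02916 — 3 statements merged into one kernel-verified Lean document; each statement's English description precedes it below -/
import Mathlib

section
/- Fix integers k > r ≥ 3 and set B = binom(k-1,r-1). For every constant C > 0 there exist a constant C' > 0 and p_0 > 0 such that the following holds for all 0 < p ≤ p_0, all n, and every symmetric function U : [n]^r → [0, 1−p] satisfying ∫ I_p(p + U(x_{[r]})) dx_{[r]} ≤ C · p^B · log(1/p): (i) ∫ U(x_{[r]}) dx_{[r]} ≤ C' · p^{(B+1)/2} · √(log(1/p)); (ii) ∫ U(x_{[r]})^2 dx_{[r]} ≤ C' · p^B; (iii) for every b ∈ (0,1], if B_b = { x ∈ [n] : d_2(x) > b } where d_2(x) = ∫ U(x, x_1, …, x_{r-1})^2 dx_{[r-1]}, then λ(B_b) ≤ C' · p^B / b, where λ(B_b) = |B_b|/n. -/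
open Finset

/-- The average of `f` over `[n]^k` (uniform measure): `n^{-k} Σ_x f(x)`. -/
noncomputable def avg {n k : ℕ} (f : (Fin k → Fin n) → ℝ) : ℝ :=
  (∑ x : Fin k → Fin n, f x) / (n : ℝ) ^ k

/-- The relative entropy function `I_p(x) = x log(x/p) + (1-x) log((1-x)/(1-p))`. -/
noncomputable def Ient (p x : ℝ) : ℝ :=
  x * Real.log (x / p) + (1 - x) * Real.log ((1 - x) / (1 - p))

/-- `d_2(x) = ∫ U(x, x₁, …, x_{r-1})² dx_{[r-1]}`: the average of `U(z)²` over the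
tuples `z` whose `i₀`-th coordinate equals `x` (for symmetric `U` the choice of the
distinguished coordinate `i₀` is immaterial). -/
noncomputable def deg2 {n r : ℕ} (U : (Fin r → Fin n) → ℝ) (i₀ : Fin r) (x : Fin n) : ℝ :=
  (∑ z : Fin r → Fin n, if z i₀ = x then U z ^ 2 else 0) / (n : ℝ) ^ (r - 1)

/-- Legendre-type lower bound for the relative entropy. -/
lemma Ient_lower_bound {p u : ℝ} (hp : 0 < p) (hp1 : p < 1) (hu : 0 ≤ u) (hu1 : u ≤ 1 - p)
    (l : ℝ) : l * (p + u) - p * (Real.exp l - 1) ≤ Ient p (p + u) := by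
  have hx : 0 < p + u := by linarith
  have h1 : l * (p + u) + (p + u) - p * Real.exp l ≤ (p + u) * Real.log ((p + u) / p) := by
    have h := Real.one_sub_inv_le_log_of_pos (div_pos hx (mul_pos hp (Real.exp_pos l)))
    rw [← div_div, Real.log_div (div_pos hx hp).ne' (Real.exp_pos l).ne', Real.log_exp] at h
    have h2 := mul_le_mul_of_nonneg_left h hx.le
    have h3 : (p + u) * (1 - ((p + u) / p / Real.exp l)⁻¹) = p + u - p * Real.exp l := by
      have := (Real.exp_pos l).ne'
      field_simp
    rw [h3] at h2
    linarith
  have h2 : -u ≤ (1 - (p + u)) * Real.log ((1 - (p + u)) / (1 - p)) := by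
    rcases (show 0 ≤ 1 - (p + u) by linarith).eq_or_lt with h0 | h0
    · rw [← h0]; simpa using hu
    · have hq : 0 < 1 - p := by linarith
      have h := mul_le_mul_of_nonneg_left
        (Real.one_sub_inv_le_log_of_pos (div_pos h0 hq)) h0.le
      have h3 : (1 - (p + u)) * (1 - ((1 - (p + u)) / (1 - p))⁻¹) = -u := by
        rw [inv_div, mul_sub, mul_div_cancel₀ _ h0.ne']
        ring
      linarith
  unfold Ient
  linarith

lemma Ient_lower_bound_of_le_one {p u l : ℝ} (hp : 0 < p) (hp1 : p < 1) (hu : 0 ≤ u)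
    (hu1 : u ≤ 1 - p) (hl : 0 ≤ l) (hl1 : l ≤ 1) : l * u - p * l ^ 2 ≤ Ient p (p + u) := by
  have h := Ient_lower_bound hp hp1 hu hu1 l
  have h2 := (abs_le.mp (Real.abs_exp_sub_one_sub_id_le (abs_le.mpr ⟨by linarith, hl1⟩))).2
  nlinarith

lemma mul_log_inv_le_half {p : ℝ} (hp : 0 < p) (hp1 : p ≤ 1 / 16) :
    p * Real.log (1 / p) ≤ 1 / 2 := by
  have hs : 0 < √p := Real.sqrt_pos.mpr hp
  have hs1 : √p ≤ 1 / 4 := Real.sqrt_le_iff.mpr ⟨by norm_num, by linarith⟩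
  have hsp : √p ^ 2 = p := Real.sq_sqrt hp.le
  have h := Real.one_sub_inv_le_log_of_pos hs
  have h3 : p * (√p)⁻¹ = √p := by
    rw [← div_eq_mul_inv, Real.div_sqrt]
  have h4 : Real.log p = 2 * Real.log √p := by
    conv_lhs => rw [← hsp, Real.log_pow]
    norm_num
  rw [one_div, Real.log_inv, h4]
  nlinarith

/-- Quadratic lower bound for the relative entropy, with the logarithmic gain. -/
lemma sq_mul_log_le_Ient {p u : ℝ} (hp : 0 < p) (hp1 : p ≤ 1 / 16) (hu : 0 ≤ u)
    (hu1 : u ≤ 1 - p) : u ^ 2 * Real.log (1 / p) ≤ 4 * Ient p (p + u) := by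
  set L := Real.log (1 / p) with hL
  have hL0 : 0 ≤ L := Real.log_nonneg (by rw [le_div_iff₀ hp]; linarith)
  have hpL : p * L ≤ 1 / 2 := mul_log_inv_le_half hp hp1
  rcases le_total (u * L) 1 with h | h
  · have h1 := Ient_lower_bound_of_le_one hp (by linarith) hu hu1 (mul_nonneg hu hL0) h
    have h2 : 0 ≤ u ^ 2 * L := by positivity
    nlinarith [mul_le_mul_of_nonneg_left hpL h2]
  · have h1 := Ient_lower_bound hp (by linarith) hu hu1 (L / 2)
    have h2 : p * Real.exp (L / 2) = √p := by
      have : L / 2 = -Real.log √p := by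
        rw [hL, one_div, Real.log_inv, Real.log_sqrt hp.le]; ring
      rw [this, Real.exp_neg, Real.exp_log (Real.sqrt_pos.mpr hp), ← div_eq_mul_inv,
        Real.div_sqrt]
    have hs1 : √p ≤ 1 / 4 := Real.sqrt_le_iff.mpr ⟨by norm_num, by linarith⟩
    have h3 : u ^ 2 * L ≤ u * L := by
      nlinarith [mul_nonneg (mul_nonneg hu hL0) (show 0 ≤ 1 - u by linarith)]
    nlinarith [mul_nonneg hp.le hL0]

lemma avg_mono {n k : ℕ} {f g : (Fin k → Fin n) → ℝ} (h : ∀ x, f x ≤ g x) : avg f ≤ avg g :=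
  div_le_div_of_nonneg_right (Finset.sum_le_sum fun x _ => h x) (by positivity)

lemma avg_mul_const {n k : ℕ} (f : (Fin k → Fin n) → ℝ) (c : ℝ) :
    avg (fun x => f x * c) = avg f * c := by
  simp only [avg, ← Finset.sum_mul]
  ring

lemma avg_sub {n k : ℕ} (f g : (Fin k → Fin n) → ℝ) :
    avg (fun x => f x - g x) = avg f - avg g := by
  simp only [avg, Finset.sum_sub_distrib]
  ring

lemma avg_const_le {n k : ℕ} {c : ℝ} (hc : 0 ≤ c) :
    avg (fun _ : Fin k → Fin n => c) ≤ c := by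
  simp only [avg, Finset.sum_const, Finset.card_univ, Fintype.card_pi_const, Fintype.card_fin,
    nsmul_eq_mul, Nat.cast_pow]
  rw [mul_comm, mul_div_assoc]
  exact mul_le_of_le_one_right hc (div_self_le_one _)

lemma sum_deg2 {n r : ℕ} (U : (Fin r → Fin n) → ℝ) (i₀ : Fin r) :
    ∑ x, deg2 U i₀ x = avg (fun z => U z ^ 2) * n := by
  obtain ⟨m, rfl⟩ : ∃ m, r = m + 1 := ⟨r - 1, by have := i₀.isLt; omega⟩
  simp only [deg2, avg, ← Finset.sum_div]
  rw [Finset.sum_comm]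
  simp only [Finset.sum_ite_eq, Finset.mem_univ, if_true, Nat.add_sub_cancel]
  rcases Nat.eq_zero_or_pos n with rfl | hn
  · simp
  · have : (n : ℝ) ≠ 0 := by positivity
    field_simp
    ring

/-- Markov's inequality for `deg2`. -/
lemma card_deg2_gt_le {n r : ℕ} (U : (Fin r → Fin n) → ℝ) (i₀ : Fin r) {b : ℝ} (hb : 0 < b) :
    ((Finset.univ.filter (fun x : Fin n => b < deg2 U i₀ x)).card : ℝ) / n ≤
      avg (fun z => U z ^ 2) / b := by
  have hnn : ∀ x, 0 ≤ deg2 U i₀ x := fun x =>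
    div_nonneg (Finset.sum_nonneg fun z _ => by split_ifs <;> positivity) (by positivity)
  have h : ((Finset.univ.filter (fun x : Fin n => b < deg2 U i₀ x)).card : ℝ) * b ≤
      avg (fun z => U z ^ 2) * n := by
    rw [← sum_deg2 U i₀, ← nsmul_eq_mul]
    exact (Finset.card_nsmul_le_sum _ _ _ fun x hx => (Finset.mem_filter.mp hx).2.le).trans
      (Finset.sum_le_sum_of_subset_of_nonneg (Finset.filter_subset _ _) fun x _ _ => hnn x)
  have h0 : 0 ≤ avg (fun z => U z ^ 2) :=
    div_nonneg (Finset.sum_nonneg fun z _ => by positivity) (by positivity)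
  rcases Nat.eq_zero_or_pos n with rfl | hn
  · simpa using div_nonneg h0 hb.le
  · rw [div_le_div_iff₀ (by positivity) hb]
    exact h

lemma two_le_choose {m j : ℕ} (hj : 0 < j) (hjm : j < m) : 2 ≤ m.choose j :=
  calc 2 ≤ j + 1 := by omega
    _ = (j + 1).choose j := by simp
    _ ≤ m.choose j := Nat.choose_le_choose j hjm

/-- **Basic estimates on functions with small relative entropy** (Lemma 4.1).
Fix `k > r ≥ 3` and set `B = C(k-1,r-1)`.  For every `C > 0` there are `C' > 0` and
`p₀ > 0` such that for `0 < p ≤ p₀` and any symmetric `U : [n]^r → [0, 1-p]` with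
`∫ I_p(p + U) ≤ C p^B log(1/p)`:
(i) `∫ U ≤ C' p^{(B+1)/2} √(log(1/p))`; (ii) `∫ U² ≤ C' p^B`;
(iii) for `b ∈ (0,1]`, the set `B_b = {x : d₂(x) > b}` has measure `≤ C' p^B / b`. -/
theorem graphon_lemma (k r : ℕ) (hr : 3 ≤ r) (hkr : r < k) :
    ∀ C : ℝ, 0 < C → ∃ C' : ℝ, 0 < C' ∧ ∃ p₀ : ℝ, 0 < p₀ ∧
      ∀ p : ℝ, 0 < p → p ≤ p₀ → ∀ n : ℕ, ∀ U : (Fin r → Fin n) → ℝ,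
        (∀ (σ : Equiv.Perm (Fin r)) (x : Fin r → Fin n), U (x ∘ σ) = U x) →
        (∀ x, 0 ≤ U x ∧ U x ≤ 1 - p) →
        avg (fun x => Ient p (p + U x)) ≤
          C * p ^ ((k - 1).choose (r - 1)) * Real.log (1 / p) →
        (avg U ≤
            C' * p ^ ((((k - 1).choose (r - 1) : ℝ) + 1) / 2) * Real.sqrt (Real.log (1 / p))) ∧
        (avg (fun x => U x ^ 2) ≤ C' * p ^ ((k - 1).choose (r - 1))) ∧
        (∀ b : ℝ, 0 < b → b ≤ 1 →
          ((Finset.univ.filter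
              (fun x : Fin n => b < deg2 U ⟨0, by omega⟩ x)).card : ℝ) / n ≤
            C' * p ^ ((k - 1).choose (r - 1)) / b) := by
  intro C hC
  refine ⟨4 * C + 1, by positivity, 1 / 16, by norm_num, ?_⟩
  intro p hp hp1 n U _ hU hI
  set B := (k - 1).choose (r - 1) with hB
  set L := Real.log (1 / p) with hL
  have hL0 : 0 < L := Real.log_pos (by rw [lt_div_iff₀ hp]; linarith)
  have hB2 : 2 ≤ B := two_le_choose (by omega) (by omega)
  have hpB : 0 < p ^ B := by positivity
  have hsq : avg (fun x => U x ^ 2) ≤ (4 * C + 1) * p ^ B := by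
    have h1 : avg (fun x => U x ^ 2) * L ≤ avg (fun x => Ient p (p + U x)) * 4 := by
      rw [← avg_mul_const, ← avg_mul_const]
      refine avg_mono fun x => ?_
      linarith [sq_mul_log_le_Ient hp hp1 (hU x).1 (hU x).2]
    refine le_of_mul_le_mul_right ?_ hL0
    nlinarith [mul_pos hpB hL0]
  refine ⟨?_, hsq, fun b hb _ => (card_deg2_gt_le U _ hb).trans
    (div_le_div_of_nonneg_right hsq hb.le)⟩
  set l := p ^ (((B : ℝ) - 1) / 2) * √L with hl
  have hl0 : 0 < l := by positivity
  have hexp : p * p ^ (((B : ℝ) - 1) / 2) = p ^ (((B : ℝ) + 1) / 2) := by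
    rw [mul_comm, ← Real.rpow_add_one hp.ne']
    ring_nf
  have hpl : p * l = p ^ (((B : ℝ) + 1) / 2) * √L := by
    rw [hl, ← mul_assoc, hexp]
  have hpl2 : p * l ^ 2 = p ^ B * L := by
    rw [sq, ← mul_assoc, hpl, hl, mul_mul_mul_comm, Real.mul_self_sqrt hL0.le,
      ← Real.rpow_add hp, ← Real.rpow_natCast]
    ring_nf
  have hl1 : l ≤ 1 := by
    have h1 : p ^ B ≤ p ^ 2 := pow_le_pow_of_le_one hp.le (by linarith) hB2
    have h2 : p * l ^ 2 ≤ p * (1 / 2) := by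
      rw [hpl2]
      nlinarith [mul_log_inv_le_half hp hp1]
    nlinarith [le_of_mul_le_mul_left h2 hp]
  have h1 : avg U * l - p * l ^ 2 ≤ C * p ^ B * L := by
    refine le_trans ?_ hI
    calc avg U * l - p * l ^ 2
        ≤ avg U * l - avg (fun _ : Fin r → Fin n => p * l ^ 2) :=
          sub_le_sub_left (avg_const_le (by positivity)) _
      _ = avg (fun x => U x * l - p * l ^ 2) := by rw [avg_sub, avg_mul_const U l]
      _ ≤ _ := avg_mono fun x => by
          rw [mul_comm (U x)]
          exact Ient_lower_bound_of_le_one hp (by linarith) (hU x).1 (hU x).2 hl0.le hl1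
  have h2 : avg U ≤ (C + 1) * (p * l) := by
    refine le_of_mul_le_mul_right ?_ hl0
    linear_combination h1 - C * hpl2
  rw [mul_assoc, ← hpl]
  nlinarith [mul_pos hp hl0]
end

section
/- There exists p_0 > 0 such that for all 0 < p ≤ p_0 and all real numbers x, b with 0 ≤ x ≤ b ≤ 1 − p − 1/log(1/p), one has I_p(p + x) ≥ (x/b)^2 · I_p(p + b). -/
open Set

lemma hasDerivAt_log_div_const {p y : ℝ} (hp : 0 < p) (hy : 0 < y) :
    HasDerivAt (fun t : ℝ => Real.log (t / p)) (1 / y) y := by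
  have h := ((hasDerivAt_id y).div_const p).log (by simp only [id]; positivity)
  refine h.congr_deriv ?_
  simp only [id]
  field_simp

lemma hasDerivAt_log_one_sub_div_const {p y : ℝ} (hp : p < 1) (hy : y < 1) :
    HasDerivAt (fun t : ℝ => Real.log ((1 - t) / (1 - p))) (-1 / (1 - y)) y := by
  have h1 : 0 < 1 - y := by linarith
  have h2 : 0 < 1 - p := by linarith
  have h := (((hasDerivAt_id y).const_sub 1).div_const (1 - p)).log
    (by simp only [id]; positivity)
  refine h.congr_deriv ?_
  simp only [id]
  field_simp

lemma hasDerivAt_Ient {p y : ℝ} (hp : 0 < p) (hp1 : p < 1) (hy : 0 < y) (hy1 : y < 1) :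
    HasDerivAt (Ient p) (Real.log (y / p) - Real.log ((1 - y) / (1 - p))) y := by
  have h1 : 1 - y ≠ 0 := by linarith
  have h := ((hasDerivAt_id y).mul (hasDerivAt_log_div_const hp hy)).add
    (((hasDerivAt_id y).const_sub 1).mul (hasDerivAt_log_one_sub_div_const hp1 hy1))
  refine h.congr_deriv ?_
  simp only [id]
  field_simp
  ring

/-- `2 * I_p(y) - (y - p) * I_p'(y)`, whose sign governs the monotonicity of
`I_p(y) / (y - p) ^ 2`. -/
noncomputable def entDefect (p y : ℝ) : ℝ :=
  (y + p) * Real.log (y / p) + (2 - y - p) * Real.log ((1 - y) / (1 - p))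

/-- The derivative of `entDefect p`. -/
noncomputable def entDefectDeriv (p y : ℝ) : ℝ :=
  Real.log (y / p) - Real.log ((1 - y) / (1 - p)) + p / y - (1 - p) / (1 - y)

lemma hasDerivAt_entDefect {p y : ℝ} (hp : 0 < p) (hp1 : p < 1) (hy : 0 < y) (hy1 : y < 1) :
    HasDerivAt (entDefect p) (entDefectDeriv p y) y := by
  have h1 : 1 - y ≠ 0 := by linarith
  have h := (((hasDerivAt_id y).add_const p).mul (hasDerivAt_log_div_const hp hy)).add
    ((((hasDerivAt_id y).const_sub 2).sub_const p).mul
      (hasDerivAt_log_one_sub_div_const hp1 hy1))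
  refine h.congr_deriv ?_
  simp only [id, entDefectDeriv]
  field_simp
  ring

lemma hasDerivAt_entDefectDeriv {p y : ℝ} (hp : 0 < p) (hp1 : p < 1) (hy : 0 < y)
    (hy1 : y < 1) :
    HasDerivAt (entDefectDeriv p) ((y - p) * (1 - 2 * y) / (y ^ 2 * (1 - y) ^ 2)) y := by
  have h1 : 1 - y ≠ 0 := by linarith
  have h := (((hasDerivAt_log_div_const hp hy).sub
    (hasDerivAt_log_one_sub_div_const hp1 hy1)).add
    ((hasDerivAt_const y p).div (hasDerivAt_id y) hy.ne')).sub
    ((hasDerivAt_const y (1 - p)).div ((hasDerivAt_id y).const_sub 1) h1)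
  refine h.congr_deriv ?_
  simp only [id]
  field_simp
  ring

lemma entDefectDeriv_nonneg {p y : ℝ} (hp : 0 < p) (hpy : p ≤ y) (hy : y ≤ 1 / 2) :
    0 ≤ entDefectDeriv p y := by
  have hd : ∀ t ∈ Icc p y, HasDerivAt (entDefectDeriv p)
      ((t - p) * (1 - 2 * t) / (t ^ 2 * (1 - t) ^ 2)) t := fun t ht =>
    hasDerivAt_entDefectDeriv hp (by linarith) (by linarith [ht.1]) (by linarith [ht.2])
  have hm : MonotoneOn (entDefectDeriv p) (Icc p y) := by
    refine monotoneOn_of_deriv_nonneg (convex_Icc p y)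
      (fun t ht => (hd t ht).continuousAt.continuousWithinAt)
      (fun t ht => (hd t (interior_subset ht)).differentiableAt.differentiableWithinAt)
      (fun t ht => ?_)
    have ht := interior_subset ht
    rw [(hd t ht).deriv]
    exact div_nonneg (mul_nonneg (by linarith [ht.1]) (by linarith [ht.2])) (by positivity)
  have h := hm (left_mem_Icc.2 hpy) (right_mem_Icc.2 hpy) hpy
  have h1 : 1 - p ≠ 0 := by linarith
  have h0 : entDefectDeriv p p = 0 := by simp [entDefectDeriv, div_self hp.ne', div_self h1]
  linarith

lemma entDefect_nonneg_of_le_half {p y : ℝ} (hp : 0 < p) (hpy : p ≤ y) (hy : y ≤ 1 / 2) :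
    0 ≤ entDefect p y := by
  have hd : ∀ t ∈ Icc p y, HasDerivAt (entDefect p) (entDefectDeriv p t) t := fun t ht =>
    hasDerivAt_entDefect hp (by linarith) (by linarith [ht.1]) (by linarith [ht.2])
  have hm : MonotoneOn (entDefect p) (Icc p y) := by
    refine monotoneOn_of_deriv_nonneg (convex_Icc p y)
      (fun t ht => (hd t ht).continuousAt.continuousWithinAt)
      (fun t ht => (hd t (interior_subset ht)).differentiableAt.differentiableWithinAt)
      (fun t ht => ?_)
    have ht := interior_subset ht
    rw [(hd t ht).deriv]
    exact entDefectDeriv_nonneg hp ht.1 (ht.2.trans hy)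
  have h := hm (left_mem_Icc.2 hpy) (right_mem_Icc.2 hpy) hpy
  have h1 : 1 - p ≠ 0 := by linarith
  have h0 : entDefect p p = 0 := by simp [entDefect, div_self hp.ne', div_self h1]
  linarith

lemma entDefect_nonneg_of_half_le {p y : ℝ} (hp : 0 < p) (hp1 : p < 1)
    (hL : 100 ≤ Real.log (1 / p)) (hy : 1 / 2 ≤ y) (hyL : y ≤ 1 - 1 / Real.log (1 / p)) :
    0 ≤ entDefect p y := by
  set L := Real.log (1 / p) with hLdef
  have hL0 : 0 < L := by linarith
  have hinv : 0 < 1 / L := by positivity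
  have hy1 : 0 < 1 - y := by linarith
  have hlogp : Real.log p = -L := by simp [hLdef]
  have hu : L - 1 ≤ Real.log (y / p) := by
    rw [Real.log_div (by linarith) hp.ne', hlogp]
    have := Real.one_sub_inv_le_log_of_pos (show 0 < y by linarith)
    have : y⁻¹ ≤ 2 := by
      rw [inv_le_comm₀ (by linarith) (by norm_num)]
      linarith
    linarith
  have hlogL : Real.log L ≤ L / 10 + 8 := by
    have h1 := Real.log_le_sub_one_of_pos (show 0 < L / 10 by positivity)
    rw [Real.log_div hL0.ne' (by norm_num)] at h1
    have h2 := Real.log_le_sub_one_of_pos (show (0 : ℝ) < 10 by norm_num)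
    linarith
  have hv : -(L / 10 + 8) ≤ Real.log ((1 - y) / (1 - p)) := by
    have h1 : Real.log (1 / L) ≤ Real.log ((1 - y) / (1 - p)) := by
      apply Real.log_le_log hinv
      rw [le_div_iff₀ (by linarith)]
      nlinarith
    rw [one_div, Real.log_inv] at h1
    linarith
  have h1 : 1 / 2 * (L - 1) ≤ (y + p) * Real.log (y / p) :=
    mul_le_mul (by linarith) hu (by linarith) (by linarith)
  have h2 : (2 - y - p) * -(L / 10 + 8) ≤ (2 - y - p) * Real.log ((1 - y) / (1 - p)) :=
    mul_le_mul_of_nonneg_left hv (by linarith)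
  have h3 : (2 - y - p) * (L / 10 + 8) ≤ 3 / 2 * (L / 10 + 8) :=
    mul_le_mul_of_nonneg_right (by linarith) (by linarith)
  unfold entDefect
  linarith

/-- There exists `p₀ > 0` such that for all `0 < p ≤ p₀` and all
`0 ≤ x ≤ b ≤ 1 − p − 1/log(1/p)`, one has `I_p(p + x) ≥ (x/b)² I_p(p + b)`. -/
theorem Ient_quadratic_lower : ∃ p₀ : ℝ, 0 < p₀ ∧
    ∀ p : ℝ, 0 < p → p ≤ p₀ →
      ∀ x b : ℝ, 0 ≤ x → x ≤ b → b ≤ 1 - p - 1 / Real.log (1 / p) →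
        (x / b) ^ 2 * Ient p (p + b) ≤ Ient p (p + x) := by
  refine ⟨Real.exp (-100), Real.exp_pos _, fun p hp hp₀ x b hx hxb hb => ?_⟩
  have hp1 : p < 1 := hp₀.trans_lt (by simp)
  have hL : 100 ≤ Real.log (1 / p) := by
    have := (Real.log_le_iff_le_exp hp).2 hp₀
    rw [one_div, Real.log_inv]
    linarith
  have hinv : 0 < 1 / Real.log (1 / p) := one_div_pos.2 (by linarith)
  have h1p : 1 - p ≠ 0 := by linarith
  rcases hx.eq_or_lt with rfl | hx
  · simp [Ient, div_self hp.ne', div_self h1p]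
  have hd : ∀ t ∈ Icc (p + x) (p + b), HasDerivAt (fun t => Ient p t / (t - p) ^ 2)
      (-entDefect p t / (t - p) ^ 3) t := fun t ht => by
    have htp : t - p ≠ 0 := by linarith [ht.1]
    have h := (hasDerivAt_Ient hp hp1 (by linarith [ht.1]) (by linarith [ht.2])).div
      (((hasDerivAt_id t).sub_const p).pow 2) (pow_ne_zero 2 htp)
    refine h.congr_deriv ?_
    simp only [id, Ient, entDefect, Pi.pow_apply]
    field_simp
    ring
  have hm : AntitoneOn (fun t => Ient p t / (t - p) ^ 2) (Icc (p + x) (p + b)) := by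
    refine antitoneOn_of_deriv_nonpos (convex_Icc _ _)
      (fun t ht => (hd t ht).continuousAt.continuousWithinAt)
      (fun t ht => (hd t (interior_subset ht)).differentiableAt.differentiableWithinAt)
      (fun t ht => ?_)
    have ht := interior_subset ht
    have htp : 0 < t - p := by linarith [ht.1]
    have hF : 0 ≤ entDefect p t := by
      rcases le_total t (1 / 2) with h | h
      · exact entDefect_nonneg_of_le_half hp (by linarith) h
      · exact entDefect_nonneg_of_half_le hp hp1 hL h (by linarith [ht.2])
    rw [(hd t ht).deriv]
    exact div_nonpos_of_nonpos_of_nonneg (by linarith) (by positivity)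
  have hle : p + x ≤ p + b := by linarith
  have h := hm (left_mem_Icc.2 hle) (right_mem_Icc.2 hle) hle
  simp only [add_sub_cancel_left] at h
  rw [le_div_iff₀ (by positivity)] at h
  calc (x / b) ^ 2 * Ient p (p + b) = Ient p (p + b) / b ^ 2 * x ^ 2 := by ring
    _ ≤ Ient p (p + x) := h
end

section
/- Let H be an r-uniform hypergraph with vertex set [v] and edges e_1, …, e_m, each an r-element subset of [v], and fix n ≥ 1. For functions g_1, …, g_m : [n]^r → ℝ define T(g_1,…,g_m) = Σ over all maps i : [v] → [n] of Π_{j=1}^m g_j(i on e_j), where (i on e_j) denotes the r-tuple of values of i at the vertices of e_j (in a fixed order). Then for every function f : [n]^r → ℝ and all functions f_2, …, f_m : [n]^r → [0,1], one has |T(f, f_2, …, f_m)| ≤ n^{v−r} · ‖f‖_□, where ‖f‖_□ = sup over functions u_1, …, u_r : [n]^{r-1} → [0,1] of | Σ_{1 ≤ i_1,…,i_r ≤ n} f(i_1,…,i_r) · Π_{k=1}^r u_k(i_1,…,i_{k-1},i_{k+1},…,i_r) |. -/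
open Finset

/-- `u : [n]^r → ℝ` does not depend on the `t`-th coordinate. -/
def IndepOfCoord {n r : ℕ} (u : (Fin r → Fin n) → ℝ) (t : Fin r) : Prop :=
  ∀ x y : Fin r → Fin n, (∀ i, i ≠ t → x i = y i) → u x = u y

/-- The cut-norm of `f : [n]^r → ℝ`: the supremum over `[0,1]`-valued functions
`u_1, …, u_r`, where `u_k` depends only on the coordinates other than the `k`-th, of
`|Σ_x f(x) Π_k u_k(x)|`. -/
noncomputable def cutNorm {n r : ℕ} (f : (Fin r → Fin n) → ℝ) : ℝ :=
  sSup { y | ∃ u : Fin r → ((Fin r → Fin n) → ℝ),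
    (∀ k x, 0 ≤ u k x ∧ u k x ≤ 1) ∧ (∀ k, IndepOfCoord (u k) k) ∧
    y = |∑ x : Fin r → Fin n, f x * ∏ k, u k x| }


theorem bddAbove_cutNorm {n r : ℕ} (f : (Fin r → Fin n) → ℝ) :
    BddAbove { y | ∃ u : Fin r → ((Fin r → Fin n) → ℝ),
      (∀ k x, 0 ≤ u k x ∧ u k x ≤ 1) ∧ (∀ k, IndepOfCoord (u k) k) ∧
      y = |∑ x : Fin r → Fin n, f x * ∏ k, u k x| } := by
  refine ⟨∑ x, |f x|, ?_⟩
  rintro _ ⟨u, hu, -, rfl⟩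
  refine (abs_sum_le_sum_abs _ _).trans (sum_le_sum fun x _ => ?_)
  rw [abs_mul, abs_of_nonneg (prod_nonneg fun k _ => (hu k x).1)]
  exact mul_le_of_le_one_right (abs_nonneg _)
    (prod_le_one (fun k _ => (hu k x).1) fun k _ => (hu k x).2)

theorem abs_sum_le_cutNorm {n r : ℕ} (f : (Fin r → Fin n) → ℝ)
    (u : Fin r → (Fin r → Fin n) → ℝ) (hu : ∀ k x, 0 ≤ u k x ∧ u k x ≤ 1)
    (hindep : ∀ k, IndepOfCoord (u k) k) :
    |∑ x, f x * ∏ k, u k x| ≤ cutNorm f :=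
  le_csSup (bddAbove_cutNorm f) ⟨u, hu, hindep, rfl⟩

/-- A product of `[0,1]`-valued functions, each independent of some coordinate, can be grouped
into a test function for the cut-norm. -/
theorem abs_sum_mul_prod_le_cutNorm {ι : Type*} [Fintype ι] {n r : ℕ}
    (f : (Fin r → Fin n) → ℝ) (g : ι → (Fin r → Fin n) → ℝ)
    (hg : ∀ j x, 0 ≤ g j x ∧ g j x ≤ 1) (t : ι → Fin r)
    (hindep : ∀ j, IndepOfCoord (g j) (t j)) :
    |∑ x, f x * ∏ j, g j x| ≤ cutNorm f := by
  have h := abs_sum_le_cutNorm f (fun k x => ∏ j with t j = k, g j x)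
    (fun k x => ⟨prod_nonneg fun j _ => (hg j x).1,
      prod_le_one (fun j _ => (hg j x).1) fun j _ => (hg j x).2⟩)
    (fun k x y hxy => prod_congr rfl fun j hj => by
      obtain rfl := (mem_filter.1 hj).2
      exact hindep j x y hxy)
  simpa only [prod_fiberwise] using h

/-- Two tuples of the same length with different underlying sets: some entry of the first is
missing from the second. -/
theorem exists_notMem_range_of_map_ne {r : ℕ} {α : Type*} (a b : Fin r ↪ α)
    (h : univ.map a ≠ univ.map b) : ∃ k, a k ∉ Set.range b := by
  by_contra! hall
  refine h (eq_of_subset_of_card_le (fun x hx => ?_) (by simp))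
  obtain ⟨k, -, rfl⟩ := mem_map.1 hx
  obtain ⟨l, hl⟩ := hall k
  exact mem_map.2 ⟨l, mem_univ l, hl⟩

/-- The codomain of an embedding is its domain together with the complement of its range. -/
noncomputable def sumComplRangeEquiv {α β : Type*} (a : α ↪ β) :
    α ⊕ {b // b ∉ Set.range a} ≃ β := by
  classical
  exact ((Equiv.ofInjective a a.injective).sumCongr (Equiv.refl _)).trans
    (Equiv.sumCompl (· ∈ Set.range a))

theorem sumComplRangeEquiv_inl {α β : Type*} (a : α ↪ β) (k : α) :
    sumComplRangeEquiv a (Sum.inl k) = a k := by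
  simp [sumComplRangeEquiv]

theorem sum_fun_eq_sum_sumElim {α β γ δ M : Type*} [Fintype (α → δ)] [Fintype (β → δ)]
    [Fintype (γ → δ)] [AddCommMonoid M] (s : α ⊕ β ≃ γ) (F : (γ → δ) → M) :
    ∑ i, F i = ∑ y : β → δ, ∑ x : α → δ, F (Sum.elim x y ∘ s.symm) := by
  rw [sum_comm, ← Fintype.sum_prod_type']
  exact (Fintype.sum_equiv
    ((Equiv.sumArrowEquivProdArrow α β δ).symm.trans (s.arrowCongr (Equiv.refl δ)))
    _ _ fun _ => rfl).symm

/-- **Counting with one cut-norm factor** (Lemma A.6).  Let `H` be an `r`-uniform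
hypergraph with vertex set `[v]` and `m+1` edges, each given as an ordered `r`-tuple of
distinct vertices (an embedding `Fin r ↪ Fin v`), with pairwise distinct underlying
vertex sets.  For functions `g_j : [n]^r → ℝ` define
`T(g_0,…,g_m) = Σ_{i : [v] → [n]} Π_j g_j(i ∘ e_j)`.  Then for any `f : [n]^r → ℝ`
and `f_1, …, f_m : [n]^r → [0,1]`, one has `|T(f, f_1, …, f_m)| ≤ n^{v−r} ‖f‖_□`. -/
theorem count_le_cutNorm {n r v m : ℕ}
    (e : Fin (m + 1) → (Fin r ↪ Fin v))
    (hdist : ∀ j j' : Fin (m + 1),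
      Finset.map (e j) Finset.univ = Finset.map (e j') Finset.univ → j = j')
    (f : (Fin r → Fin n) → ℝ)
    (fs : Fin m → (Fin r → Fin n) → ℝ)
    (hrange : ∀ j x, 0 ≤ fs j x ∧ fs j x ≤ 1) :
    |∑ i : Fin v → Fin n,
        f (fun a => i (e 0 a)) * ∏ j : Fin m, fs j (fun a => i (e j.succ a))| ≤
      (n : ℝ) ^ (v - r) * cutNorm f := by
  set s := sumComplRangeEquiv (e 0) with hs
  have hsymm : ∀ k, s.symm (e 0 k) = Sum.inl k := fun k => by
    rw [Equiv.symm_apply_eq, hs, sumComplRangeEquiv_inl]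
  have hcard : Fintype.card ({b // b ∉ Set.range (e 0)} → Fin n) = n ^ (v - r) := by
    have h := Fintype.card_congr s
    rw [Fintype.card_sum, Fintype.card_fin, Fintype.card_fin] at h
    rw [Fintype.card_fun, Fintype.card_fin, Nat.eq_sub_of_add_eq' h]
  have hmissing : ∀ j : Fin m, ∃ k, e 0 k ∉ Set.range (e j.succ) := fun j =>
    exists_notMem_range_of_map_ne _ _ fun h => (Fin.succ_ne_zero j).symm (hdist _ _ h)
  choose t ht using hmissing
  rw [sum_fun_eq_sum_sumElim s]
  calc _ ≤ ∑ _y : {b // b ∉ Set.range (e 0)} → Fin n, cutNorm f := by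
        refine (abs_sum_le_sum_abs _ _).trans (sum_le_sum fun y _ => ?_)
        simp only [Function.comp_apply, hsymm, Sum.elim_inl]
        refine abs_sum_mul_prod_le_cutNorm f
          (fun j x => fs j fun a => Sum.elim x y (s.symm (e j.succ a)))
          (fun j x => hrange j _) t fun j x x' hx => ?_
        refine congrArg (fs j) (funext fun a => ?_)
        rcases h : s.symm (e j.succ a) with k | b
        · refine hx k fun hk => ht j ⟨a, ?_⟩
          rw [← hk]
          exact s.symm.injective (h.trans (hsymm k).symm)
        · rfl
    _ = (n : ℝ) ^ (v - r) * cutNorm f := by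
        rw [sum_const, card_univ, hcard, nsmul_eq_mul, Nat.cast_pow]
end
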